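/- Under the sector setup (see context), write p = λu + μv with λ, μ > 0, and define f(λ,μ) := (λ+μ)(λ+μ−1)/(4λμ) and g(λ,μ) := (1/4)·(λ+μ−1)²·min{1/[μ(1+λ/4+μ)], 1/[λ(1+λ+μ/4)], 1/(λμ)}. Suppose |C|·|C*| ≤ (1+ε)·f(λ,μ) for some ε ∈ (0, g(λ,μ)/(4f(λ,μ))). Let α_± := [1 ± √(1 − (4f(λ,μ)/g(λ,μ))·ε)]/2, and assume α₊ + (1−α₊)·min{(1−λ)/μ, (1−μ)/λ} > 0. Then either C ⊆ [1+(λ+μ−1)α₋]·[o,u,v], or C ⊇ [α₊ + (1−α₊)·min{(1−λ)/μ, (1−μ)/λ}]·[o,u,v,p]. -/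

import Mathlib

open MeasureTheory Pointwise Real
open scoped RealInnerProductSpace

/-- Area (two-dimensional Lebesgue measure) of a subset of the plane `ℂ ≅ ℝ²`. -/
noncomputable def area (K : Set ℂ) : ℝ := (volume K).toReal

/-- The polar body `K* = {x : ⟨x,y⟩ ≤ 1 for all y ∈ K}`. -/
def polarBody (K : Set ℂ) : Set ℂ := {x | ∀ y ∈ K, ⟪x, y⟫ ≤ 1}

/-- A convex body: a compact convex set with nonempty interior. -/
def IsConvexBody (K : Set ℂ) : Prop := Convex ℝ K ∧ IsCompact K ∧ (interior K).Nonempty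

/-- The signed area of the parallelogram spanned by `z` and `w`. -/
def planeCross (z w : ℂ) : ℝ := z.re * w.im - z.im * w.re

theorem real_inner_eq (z w : ℂ) : ⟪z, w⟫ = z.re * w.re + z.im * w.im := by
  rw [Complex.inner]; simp; ring

theorem volume_standard_triangle :
    volume {z : ℂ | 0 < z.re ∧ 0 < z.im ∧ z.re + z.im < 1} = ENNReal.ofReal (1 / 2) := by
  have h : {z : ℂ | 0 < z.re ∧ 0 < z.im ∧ z.re + z.im < 1} =
      Complex.measurableEquivRealProd ⁻¹'
        regionBetween (fun _ => 0) (fun x => 1 - x) (Set.Ioo (0 : ℝ) 1) := by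
    ext z
    simp only [regionBetween, Set.mem_ofPred_eq, Set.mem_preimage, Set.mem_Ioo,
      Complex.measurableEquivRealProd_apply]
    constructor
    · rintro ⟨h1, h2, h3⟩; refine ⟨⟨h1, ?_⟩, h2, ?_⟩ <;> linarith
    · rintro ⟨⟨h1, _⟩, h2, h3⟩; refine ⟨h1, h2, ?_⟩; linarith
  have hi : IntegrableOn (fun x : ℝ => 1 - x) (Set.Ioo 0 1) :=
    (Continuous.integrableOn_Icc (by fun_prop)).mono_set Set.Ioo_subset_Icc_self
  rw [h, Complex.volume_preserving_equiv_real_prod.measure_preimage_equiv,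
    Measure.volume_eq_prod, volume_regionBetween_eq_integral (integrableOn_const (by simp)) hi
      measurableSet_Ioo (fun x hx => by linarith [hx.2])]
  congr 1
  rw [← integral_Ioc_eq_integral_Ioo, ← intervalIntegral.integral_of_le zero_le_one]
  simp only [Pi.sub_apply, sub_zero]
  rw [intervalIntegral.integral_sub (by simp) (by simp)]
  norm_num

theorem half_abs_cross_le_area {S : Set ℂ} (hS : volume S ≠ ⊤) {x y : ℂ}
    (h : ∀ a b : ℝ, 0 < a → 0 < b → a + b < 1 → a • x + b • y ∈ S) :
    |planeCross x y| / 2 ≤ area S := by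
  let T : ℂ →ₗ[ℝ] ℂ := Complex.reLm.smulRight x + Complex.imLm.smulRight y
  have hT : LinearMap.det T = planeCross x y := by
    rw [← LinearMap.det_toMatrix Complex.basisOneI, Matrix.det_fin_two]
    simp [LinearMap.toMatrix_apply, T, planeCross]
    ring
  have hsub : T '' {z : ℂ | 0 < z.re ∧ 0 < z.im ∧ z.re + z.im < 1} ⊆ S := by
    rintro _ ⟨z, ⟨h1, h2, h3⟩, rfl⟩
    simpa [T] using h z.re z.im h1 h2 h3
  have hle := measure_mono (μ := volume) hsub
  rw [Measure.addHaar_image_linearMap, hT, volume_standard_triangle,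
    ← ENNReal.ofReal_mul (abs_nonneg _)] at hle
  have := (ENNReal.ofReal_le_iff_le_toReal hS).1 hle
  unfold area
  linarith

theorem add_area_le_of_disjoint {S A B : Set ℂ} (hS : volume S ≠ ⊤) (hA : A ⊆ S) (hB : B ⊆ S)
    (hBm : MeasurableSet B) (hAB : Disjoint A B) : area A + area B ≤ area S := by
  unfold area
  rw [← ENNReal.toReal_add (measure_ne_top_of_subset hA hS) (measure_ne_top_of_subset hB hS),
    ← measure_union hAB hBm]
  exact ENNReal.toReal_mono hS (measure_mono (Set.union_subset hA hB))

theorem planeCross_smul_add_right (x y z : ℂ) (a b : ℝ) :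
    planeCross z (a • x + b • y) = a * planeCross z x + b * planeCross z y := by
  simp [planeCross]; ring

theorem planeCross_smul_add_left (x y z : ℂ) (a b : ℝ) :
    planeCross (a • x + b • y) z = a * planeCross x z + b * planeCross y z := by
  simp [planeCross]; ring

theorem planeCross_self (x : ℂ) : planeCross x x = 0 := by
  simp [planeCross]; ring

/-- The open angular sector from `x` to `y`, oriented by the sign of `κ`. -/
def openSector (κ : ℝ) (x y : ℂ) : Set ℂ := {w | 0 < κ * planeCross x w ∧ 0 < κ * planeCross w y}

theorem measurableSet_openSector (κ : ℝ) (x y : ℂ) : MeasurableSet (openSector κ x y) := by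
  apply IsOpen.measurableSet
  apply IsOpen.inter
  · exact isOpen_lt (f := fun _ => 0) (g := fun w => κ * planeCross x w)
      continuous_const (by unfold planeCross; fun_prop)
  · exact isOpen_lt (f := fun _ => 0) (g := fun w => κ * planeCross w y)
      continuous_const (by unfold planeCross; fun_prop)

theorem disjoint_openSector (κ : ℝ) (x y z : ℂ) :
    Disjoint (openSector κ x y) (openSector κ y z) := by
  rw [Set.disjoint_left]
  rintro w ⟨_, h1⟩ ⟨h2, _⟩
  have : planeCross w y = - planeCross y w := by unfold planeCross; ring
  rw [this] at h1
  linarith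

theorem Convex.smul_add_smul_mem_of_zero_mem {S : Set ℂ} (hS : Convex ℝ S) (h0 : (0 : ℂ) ∈ S)
    {x y : ℂ} (hx : x ∈ S) (hy : y ∈ S) {a b : ℝ} (ha : 0 ≤ a) (hb : 0 ≤ b) (hab : a + b ≤ 1) :
    a • x + b • y ∈ S := by
  have := hS.sum_mem (t := Finset.univ) (w := ![a, b, 1 - a - b]) (z := ![x, y, 0])
    (by intro i _; fin_cases i <;> simp <;> linarith)
    (by simp [Fin.sum_univ_three])
    (by intro i _; fin_cases i <;> simp [hx, hy, h0])
  simpa [Fin.sum_univ_three] using this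

theorem half_cross_le_area_inter_openSector {κ : ℝ} {S : Set ℂ} (hS : volume S ≠ ⊤) {x y : ℂ}
    (hxy : 0 ≤ κ * planeCross x y)
    (h : 0 < κ * planeCross x y →
      ∀ a b : ℝ, 0 < a → 0 < b → a + b < 1 → a • x + b • y ∈ S) :
    κ * planeCross x y / 2 ≤ |κ| * area (S ∩ openSector κ x y) := by
  rcases hxy.eq_or_lt with h0 | hpos
  · rw [← h0]
    have : 0 ≤ area (S ∩ openSector κ x y) := ENNReal.toReal_nonneg
    simp only [zero_div]
    positivity
  · have := half_abs_cross_le_area (S := S ∩ openSector κ x y) (x := x) (y := y)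
      (measure_ne_top_of_subset Set.inter_subset_left hS) (fun a b ha hb hab =>
        ⟨h hpos a b ha hb hab, by
          constructor
          · rw [planeCross_smul_add_right, planeCross_self]
            have := mul_pos hb hpos
            linarith
          · rw [planeCross_smul_add_left, planeCross_self]
            have := mul_pos ha hpos
            linarith⟩)
    have h2 := mul_le_mul_of_nonneg_left this (abs_nonneg κ)
    have h3 : |κ| * |planeCross x y| = κ * planeCross x y := by rw [← abs_mul, abs_of_pos hpos]
    linarith

theorem half_fan_le_area_inter_openSector {κ : ℝ} {S : Set ℂ} (hS : volume S ≠ ⊤)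
    (hm : MeasurableSet S) (hconv : Convex ℝ S) (h0 : (0 : ℂ) ∈ S) {x y z : ℂ}
    (hx : x ∈ S) (hy : y ∈ S) (hz : z ∈ S) (hxy : 0 ≤ κ * planeCross x y)
    (hyz : 0 ≤ κ * planeCross y z) (hxz : 0 < κ * planeCross x z) :
    κ * (planeCross x y + planeCross y z) / 2 ≤ |κ| * area (S ∩ openSector κ x z) := by
  have hT : volume (S ∩ openSector κ x z) ≠ ⊤ := measure_ne_top_of_subset Set.inter_subset_left hS
  have h1 := half_cross_le_area_inter_openSector hT hxy (fun hpos a b ha hb hab =>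
    ⟨hconv.smul_add_smul_mem_of_zero_mem h0 hx hy ha.le hb.le hab.le, by
      constructor
      · rw [planeCross_smul_add_right, planeCross_self]
        have := mul_pos hb hpos
        linarith
      · rw [planeCross_smul_add_left]
        have := mul_pos ha hxz
        have := mul_nonneg hb.le hyz
        linarith⟩)
  have h2 := half_cross_le_area_inter_openSector hT hyz (fun hpos a b ha hb hab =>
    ⟨hconv.smul_add_smul_mem_of_zero_mem h0 hy hz ha.le hb.le hab.le, by
      constructor
      · rw [planeCross_smul_add_right]
        have := mul_pos hb hxz
        have := mul_nonneg ha.le hxy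
        linarith
      · rw [planeCross_smul_add_left, planeCross_self]
        have := mul_pos ha hpos
        linarith⟩)
  have h3 := add_area_le_of_disjoint hT Set.inter_subset_left Set.inter_subset_left
    ((hm.inter (measurableSet_openSector κ x z)).inter (measurableSet_openSector κ y z))
    ((disjoint_openSector κ x y z).mono Set.inter_subset_right Set.inter_subset_right)
  have h4 := mul_le_mul_of_nonneg_left h3 (abs_nonneg κ)
  linarith

theorem half_fan_le_area {κ : ℝ} {S : Set ℂ} (hS : volume S ≠ ⊤)
    (hm : MeasurableSet S) (hconv : Convex ℝ S) (h0 : (0 : ℂ) ∈ S) {x y z y' z' : ℂ}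
    (hx : x ∈ S) (hy : y ∈ S) (hz : z ∈ S) (hy' : y' ∈ S) (hz' : z' ∈ S)
    (hxy : 0 ≤ κ * planeCross x y) (hyz : 0 ≤ κ * planeCross y z)
    (hxz : 0 < κ * planeCross x z)
    (hzy' : 0 ≤ κ * planeCross z y') (hyz' : 0 ≤ κ * planeCross y' z')
    (hzz' : 0 < κ * planeCross z z') :
    κ * (planeCross x y + planeCross y z + planeCross z y' + planeCross y' z') / 2 ≤
      |κ| * area S := by
  have h1 := half_fan_le_area_inter_openSector hS hm hconv h0 hx hy hz hxy hyz hxz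
  have h2 := half_fan_le_area_inter_openSector hS hm hconv h0 hz hy' hz' hzy' hyz' hzz'
  have h3 := add_area_le_of_disjoint hS Set.inter_subset_left Set.inter_subset_left
    (hm.inter (measurableSet_openSector κ z z'))
    ((disjoint_openSector κ x z z').mono Set.inter_subset_right Set.inter_subset_right)
  have h4 := mul_le_mul_of_nonneg_left h3 (abs_nonneg κ)
  linarith

theorem sector_numeric_aux {lam mu q₁ q₂ η₁ η₂ M s₁ s₂ : ℝ} (hlam : 0 < lam) (hmu : 0 < mu)
    (hq₁ : 0 < q₁) (hq₂ : 0 < q₂) (hη₁ : 0 ≤ η₁) (hη₂ : 0 ≤ η₂) (hM0 : 0 ≤ M) (hM1 : M ≤ 1)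
    (hM₁ : M * (q₁ + η₂) ≤ mu) (hM₂ : M * (q₂ + η₁) ≤ lam) (hs : q₁ + q₂ ≤ lam + mu)
    (hs₁ : 1 ≤ s₁) (hs₂ : 1 ≤ s₂) (hsc₂ : q₁ * s₂ ≤ q₁ + η₂) (hss : s₁ ≤ s₂) :
    (q₁ + q₂) * (lam + mu + (η₁ + η₂) * M) ≤
      (q₂ * s₁ + q₁ * s₂) *
        (lam * ((q₂ + η₁) / q₂) / s₁ + mu * ((q₁ + η₂) / q₁) / s₂) := by
  have hs₁0 : 0 < s₁ := by linarith
  have hs₂0 : 0 < s₂ := by linarith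
  obtain ⟨R, hR⟩ : ∃ R, R = s₂ / s₁ := ⟨_, rfl⟩
  have hR1 : 1 ≤ R := by rw [hR, le_div_iff₀ hs₁0]; linarith
  have hRs : q₁ * R ≤ q₁ + η₂ := by
    have : R ≤ s₂ := by rw [hR]; exact div_le_self hs₂0.le hs₁
    nlinarith
  have hR0 : 0 < R := by linarith
  have hexp : (q₂ * s₁ + q₁ * s₂) *
        (lam * ((q₂ + η₁) / q₂) / s₁ + mu * ((q₁ + η₂) / q₁) / s₂) =
      lam * (q₂ + η₁) + mu * (q₁ + η₂) + mu * q₂ * (q₁ + η₂) / q₁ / R +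
        lam * q₁ * R + lam * q₁ * R * η₁ / q₂ := by
    have : s₂ = R * s₁ := by rw [hR]; field_simp
    rw [this]
    field_simp
    ring
  rw [hexp]
  have h1 : (q₁ + q₂) * (η₁ * M) ≤ lam * η₁ + lam * q₁ * R * η₁ / q₂ := by
    have hA : lam * η₁ + lam * q₁ * η₁ / q₂ ≤ lam * η₁ + lam * q₁ * R * η₁ / q₂ := by
      have := mul_le_mul_of_nonneg_right
        (le_mul_of_one_le_right (mul_pos hlam hq₁).le hR1) hη₁
      have := div_le_div_of_nonneg_right this hq₂.le
      linarith
    have hB : lam * η₁ + lam * q₁ * η₁ / q₂ = lam * η₁ * (q₁ + q₂) / q₂ := by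
      field_simp; ring
    have hC : (q₁ + q₂) * (η₁ * M) ≤ lam * η₁ * (q₁ + q₂) / q₂ := by
      rw [le_div_iff₀ hq₂]
      have : M * q₂ ≤ lam := by nlinarith
      have := mul_le_mul_of_nonneg_left this (mul_nonneg hη₁ (add_pos hq₁ hq₂).le)
      linarith
    linarith
  have h2 : (q₁ + q₂) * (η₂ * M) ≤
      mu * η₂ + (mu * q₂ * (q₁ + η₂) / q₁ / R - mu * q₂) + lam * q₁ * (R - 1) := by
    have hc : 0 < q₁ + η₂ := by linarith
    obtain ⟨y, hy⟩ : ∃ y, y = q₁ + η₂ - q₁ * R := ⟨_, rfl⟩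
    have hy0 : 0 ≤ y := by linarith
    have hA : mu * q₂ * y / (q₁ + η₂) ≤ mu * q₂ * (q₁ + η₂) / q₁ / R - mu * q₂ := by
      have : mu * q₂ * (q₁ + η₂) / q₁ / R - mu * q₂ = mu * q₂ * y / (q₁ * R) := by
        rw [hy]; field_simp
      rw [this]
      gcongr
    obtain ⟨x, hx⟩ : ∃ x, x = q₁ * R - q₁ := ⟨_, rfl⟩
    have hx0 : 0 ≤ x := by nlinarith
    have hη : η₂ = x + y := by rw [hx, hy]; ring
    have hB : (q₁ + q₂) * (y * M) ≤ mu * y + mu * q₂ * y / (q₁ + η₂) := by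
      have : mu * y + mu * q₂ * y / (q₁ + η₂) = mu * y * (q₁ + η₂ + q₂) / (q₁ + η₂) := by
        field_simp
      rw [this, le_div_iff₀ hc]
      have e1 := mul_le_mul_of_nonneg_left hM₁ (mul_nonneg hy0 (add_pos hq₁ hq₂).le)
      have e2 := mul_nonneg (mul_nonneg hmu.le hy0) hη₂
      nlinarith
    have hC : (q₁ + q₂) * (x * M) ≤ mu * x + lam * x := by
      have : (q₁ + q₂) * M ≤ lam + mu := by nlinarith
      nlinarith
    have hD : lam * q₁ * (R - 1) = lam * x := by rw [hx]; ring
    have hE : mu * η₂ = mu * x + mu * y := by rw [hη]; ring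
    have hF : (q₁ + q₂) * (η₂ * M) = (q₁ + q₂) * (x * M) + (q₁ + q₂) * (y * M) := by
      rw [hη]; ring
    linarith
  linarith

theorem sector_numeric {lam mu q₁ q₂ η₁ η₂ M s₁ s₂ : ℝ} (hlam : 0 < lam) (hmu : 0 < mu)
    (hq₁ : 0 < q₁) (hq₂ : 0 < q₂) (hη₁ : 0 ≤ η₁) (hη₂ : 0 ≤ η₂) (hM0 : 0 ≤ M) (hM1 : M ≤ 1)
    (hM₁ : M * (q₁ + η₂) ≤ mu) (hM₂ : M * (q₂ + η₁) ≤ lam) (hs : q₁ + q₂ ≤ lam + mu)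
    (hs₁ : 1 ≤ s₁) (hs₂ : 1 ≤ s₂) (hsc₁ : q₂ * s₁ ≤ q₂ + η₁) (hsc₂ : q₁ * s₂ ≤ q₁ + η₂) :
    (q₁ + q₂) * (lam + mu + (η₁ + η₂) * M) ≤
      (q₂ * s₁ + q₁ * s₂) *
        (lam * ((q₂ + η₁) / q₂) / s₁ + mu * ((q₁ + η₂) / q₁) / s₂) := by
  rcases le_total s₁ s₂ with h | h
  · exact sector_numeric_aux hlam hmu hq₁ hq₂ hη₁ hη₂ hM0 hM1 hM₁ hM₂ hs hs₁ hs₂ hsc₂ h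
  · have := sector_numeric_aux hmu hlam hq₂ hq₁ hη₂ hη₁ hM0 hM1 hM₂ hM₁ (by linarith) hs₂ hs₁ hsc₁ h
    linarith

theorem planeCross_combination (u v : ℂ) (a b c d : ℝ) :
    planeCross (a • u + b • v) (c • u + d • v) = (a * d - b * c) * planeCross u v := by
  simp [planeCross]; ring

theorem planeCross_mul_planeCross (y z u v : ℂ) :
    planeCross u v * planeCross y z = ⟪y, u⟫ * ⟪z, v⟫ - ⟪y, v⟫ * ⟪z, u⟫ := by
  simp only [planeCross, real_inner_eq]; ring

theorem convex_polarBody (K : Set ℂ) : Convex ℝ (polarBody K) := by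
  intro x hx z hz a b ha hb hab y hy
  rw [inner_add_left, real_inner_smul_left, real_inner_smul_left]
  have := hx y hy
  have := hz y hy
  nlinarith

theorem isClosed_polarBody (K : Set ℂ) : IsClosed (polarBody K) := by
  have : polarBody K = ⋂ y ∈ K, {x : ℂ | ⟪x, y⟫ ≤ 1} := by
    ext x; simp [polarBody]
  rw [this]
  exact isClosed_biInter fun y _ => isClosed_le (by fun_prop) continuous_const

theorem zero_mem_polarBody (K : Set ℂ) : (0 : ℂ) ∈ polarBody K := by
  intro y _; simp

theorem isCompact_convexHull_four (x y z w : ℂ) : IsCompact (convexHull ℝ {x, y, z, w}) :=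
  (Set.toFinite _).isCompact_convexHull ℝ

theorem smul_add_smul_mem_sector_hull {u v p : ℂ} {lam mu x₁ x₂ : ℝ} (hlam : 0 < lam)
    (hmu : 0 < mu) (hp : p = lam • u + mu • v) (hx₁ : 0 ≤ x₁) (hx₂ : 0 ≤ x₂)
    (h₁ : mu * x₁ + (1 - lam) * x₂ ≤ mu) (h₂ : (1 - mu) * x₁ + lam * x₂ ≤ lam) :
    x₁ • u + x₂ • v ∈ convexHull ℝ {0, u, v, p} := by
  have hc := convex_convexHull ℝ ({0, u, v, p} : Set ℂ)
  have h0 : (0 : ℂ) ∈ convexHull ℝ {0, u, v, p} := subset_convexHull ℝ _ (by simp)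
  have hu : u ∈ convexHull ℝ {0, u, v, p} := subset_convexHull ℝ _ (by simp)
  have hv : v ∈ convexHull ℝ {0, u, v, p} := subset_convexHull ℝ _ (by simp)
  have hpm : p ∈ convexHull ℝ {0, u, v, p} := subset_convexHull ℝ _ (by simp)
  rcases le_total (lam * x₂) (mu * x₁) with h | h
  · have := hc.smul_add_smul_mem_of_zero_mem h0 hpm hu (a := x₂ / mu) (b := x₁ - lam * x₂ / mu)
      (by positivity) (by rw [sub_nonneg, div_le_iff₀ hmu]; linarith) (by
        have : x₂ / mu + (x₁ - lam * x₂ / mu) = (mu * x₁ + (1 - lam) * x₂) / mu := by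
          field_simp; ring
        rw [this, div_le_one hmu]; exact h₁)
    convert this using 1
    rw [hp]
    match_scalars
    · field_simp; ring
    · field_simp
  · have := hc.smul_add_smul_mem_of_zero_mem h0 hpm hv (a := x₁ / lam) (b := x₂ - mu * x₁ / lam)
      (by positivity) (by rw [sub_nonneg, div_le_iff₀ hlam]; linarith) (by
        have : x₁ / lam + (x₂ - mu * x₁ / lam) = ((1 - mu) * x₁ + lam * x₂) / lam := by
          field_simp; ring
        rw [this, div_le_one hlam]; exact h₂)
    convert this using 1
    rw [hp]
    match_scalars
    · field_simp
    · field_simp; ring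
theorem exists_sector_side {K : Set ℂ} (hcomp : IsCompact K) {u v us ps : ℂ} (hu : u ∈ K)
    (hus : us ∈ polarBody K) (husu : ⟪us, u⟫ = 1) (hpsu : ⟪ps, u⟫ = 1) (hpsv : ⟪ps, v⟫ = 1)
    {lam mu α q₁ q₂ : ℝ} (hmu : 0 < mu) (hα : 0 < α) (hσ : 1 < lam + mu)
    (husv : lam + mu * ⟪us, v⟫ = 1) (hq₂ : 0 < q₂)
    (hqs : q₁ + q₂ = 1 + α * (lam + mu - 1)) (hqα : α * mu ≤ q₂)
    (hmax : ∀ y ∈ K, ⟪ps, y⟫ ≤ q₁ + q₂)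
    (hcoord : ∀ y ∈ K, ∃ y₁ y₂ : ℝ, y = y₁ • u + y₂ • v) :
    ∃ (x₁ x₂ t : ℝ) (P : ℂ), x₁ • u + x₂ • v ∈ K ∧ 0 ≤ x₂ ∧ 0 ≤ x₁ * q₂ - x₂ * q₁ ∧
      1 ≤ t ∧ q₂ * t ≤ q₂ + (q₂ - α * mu) * (q₁ + q₂ - 1) ∧
      q₂ * x₁ + (1 - q₁) * x₂ = q₂ * t ∧ t⁻¹ • P ∈ polarBody K ∧
      P = (α * mu / q₂) • us + (1 - α * mu / q₂) • ps := by
  obtain ⟨P, hP⟩ : ∃ P, P = (α * mu / q₂) • us + (1 - α * mu / q₂) • ps := ⟨_, rfl⟩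
  have hPu : ⟪P, u⟫ = 1 := by
    rw [hP, inner_add_left, real_inner_smul_left, real_inner_smul_left, husu, hpsu]; ring
  have hPv : ⟪P, v⟫ = (1 - q₁) / q₂ := by
    rw [hP, inner_add_left, real_inner_smul_left, real_inner_smul_left, hpsv]
    field_simp
    linear_combination α * husv + hqs
  obtain ⟨x, hx, hxmax⟩ := hcomp.exists_isMaxOn ⟨u, hu⟩
    (f := fun y => ⟪P, y⟫) (by fun_prop)
  have hxmax' : ∀ y ∈ K, ⟪P, y⟫ ≤ ⟪P, x⟫ := fun y hy => hxmax hy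
  have h1 : 1 ≤ ⟪P, x⟫ := by rw [← hPu]; exact hxmax' u hu
  have hval : ∀ y₁ y₂ : ℝ, q₂ * ⟪P, y₁ • u + y₂ • v⟫ = q₂ * y₁ + (1 - q₁) * y₂ := by
    intro y₁ y₂
    rw [inner_add_right, real_inner_smul_right, real_inner_smul_right, hPu, hPv]
    field_simp
  have hbound : q₂ * ⟪P, x⟫ ≤ q₂ + (q₂ - α * mu) * (q₁ + q₂ - 1) := by
    have e1 := hus x hx
    have e2 := hmax x hx
    have : q₂ * ⟪P, x⟫ = α * mu * ⟪us, x⟫ + (q₂ - α * mu) * ⟪ps, x⟫ := by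
      rw [hP, inner_add_left, real_inner_smul_left, real_inner_smul_left]
      field_simp
    rw [this]
    have := mul_le_mul_of_nonneg_left e1 (mul_pos hα hmu).le
    have := mul_le_mul_of_nonneg_left e2 (sub_nonneg.2 hqα)
    linarith
  have hpol : (⟪P, x⟫)⁻¹ • P ∈ polarBody K := by
    intro y hy
    rw [real_inner_smul_left, inv_mul_le_iff₀ (by linarith), mul_one]
    exact hxmax' y hy
  rcases h1.eq_or_lt with h | h
  · refine ⟨1, 0, 1, P, by simpa using hu, le_rfl, by linarith, le_rfl, ?_, by ring, ?_, hP⟩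
    · rw [← h] at hbound; exact hbound
    · rw [← h] at hpol; exact hpol
  · obtain ⟨x₁, x₂, rfl⟩ := hcoord x hx
    have e1 := hus _ hx
    have e2 := hmax _ hx
    have e3 := hval x₁ x₂
    rw [inner_add_right, real_inner_smul_right, real_inner_smul_right] at e1 e2
    rw [husu] at e1
    rw [hpsu, hpsv] at e2
    have hlt : q₂ < q₂ * x₁ + (1 - q₁) * x₂ := by
      rw [← e3]; exact lt_mul_of_one_lt_right hq₂ h
    have hqa : (1 - q₁ - ⟪us, v⟫ * q₂) * mu = (q₂ - α * mu) * (lam + mu - 1) := by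
      linear_combination -q₂ * husv - mu * hqs
    have hfac : 0 ≤ 1 - q₁ - ⟪us, v⟫ * q₂ := by
      have : 0 ≤ (1 - q₁ - ⟪us, v⟫ * q₂) * mu := by
        rw [hqa]; exact mul_nonneg (by linarith) (by linarith)
      exact nonneg_of_mul_nonneg_left this hmu
    have hx₂ : 0 < x₂ := by
      have : 0 < (1 - q₁ - ⟪us, v⟫ * q₂) * x₂ := by nlinarith
      by_contra hn
      linarith [mul_nonpos_of_nonneg_of_nonpos hfac (not_lt.1 hn)]
    refine ⟨x₁, x₂, _, P, hx, hx₂.le, ?_, h1, hbound, e3.symm, hpol, hP⟩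
    have hs : 0 < q₁ + q₂ - 1 := by
      rw [hqs]; have := mul_pos hα (sub_pos.2 hσ); linarith
    have : 0 ≤ (q₁ + q₂ - 1) * (x₁ * q₂ - x₂ * q₁) := by nlinarith
    exact nonneg_of_mul_nonneg_right this hs

set_option maxHeartbeats 1000000 in
theorem sector_area_mul_area_ge {K : Set ℂ} (hconv : Convex ℝ K) (hcomp : IsCompact K)
    (h0 : (0 : ℂ) ∈ K) {u v us vs p ps : ℂ} (hd : planeCross u v ≠ 0) (hu : u ∈ K) (hv : v ∈ K)
    (hus : us ∈ polarBody K) (hvs : vs ∈ polarBody K)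
    (husu : ⟪us, u⟫ = 1) (hvsv : ⟪vs, v⟫ = 1) (hpsu : ⟪ps, u⟫ = 1) (hpsv : ⟪ps, v⟫ = 1)
    {lam mu α q₁ q₂ M : ℝ} (hlam : 0 < lam) (hmu : 0 < mu) (hσ : 1 < lam + mu)
    (hp : p = lam • u + mu • v)
    (husv : lam + mu * ⟪us, v⟫ = 1) (hvsu : mu + lam * ⟪vs, u⟫ = 1)
    (hα : 0 < α) (hα1 : α ≤ 1) (hq : q₁ • u + q₂ • v ∈ K)
    (hqs : q₁ + q₂ = 1 + α * (lam + mu - 1)) (hmax : ∀ y ∈ K, ⟪ps, y⟫ ≤ q₁ + q₂)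
    (hcoord : ∀ y ∈ K, ∃ y₁ y₂ : ℝ, y = y₁ • u + y₂ • v)
    (hM0 : 0 ≤ M) (hM1 : M ≤ 1) (hM₁ : M * (1 + lam + mu / 4) ≤ mu)
    (hM₂ : M * (1 + lam / 4 + mu) ≤ lam) :
    (lam + mu - 1) * (lam + mu + α * (1 - α) * (lam + mu - 1) * M) / (4 * lam * mu) ≤
      area (K ∩ convexHull ℝ {0, u, v, p}) *
        area (polarBody K ∩ convexHull ℝ {0, us, vs, ps}) := by
  have hσ0 : 0 < lam + mu - 1 := by linarith
  have hcon : ∀ x₁ x₂ : ℝ, x₁ • u + x₂ • v ∈ K →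
      mu * x₁ + (1 - lam) * x₂ ≤ mu ∧ (1 - mu) * x₁ + lam * x₂ ≤ lam := by
    intro x₁ x₂ hx
    have e1 := hus _ hx
    have e2 := hvs _ hx
    rw [inner_add_right, real_inner_smul_right, real_inner_smul_right] at e1 e2
    rw [husu] at e1
    rw [hvsv] at e2
    have e3 := mul_le_mul_of_nonneg_left e1 hmu.le
    have e4 := mul_le_mul_of_nonneg_left e2 hlam.le
    constructor
    · linear_combination e3 - x₂ * husv
    · linear_combination e4 - x₁ * hvsu
  obtain ⟨hq1c, hq2c⟩ := hcon q₁ q₂ hq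
  have hqα₂ : α * mu ≤ q₂ := by
    have : 0 ≤ (lam + mu - 1) * (q₂ - α * mu) := by linear_combination hq1c - mu * hqs
    linarith [nonneg_of_mul_nonneg_right this hσ0]
  have hqα₁ : α * lam ≤ q₁ := by
    have : 0 ≤ (lam + mu - 1) * (q₁ - α * lam) := by linear_combination hq2c - lam * hqs
    linarith [nonneg_of_mul_nonneg_right this hσ0]
  have hq₁ : 0 < q₁ := lt_of_lt_of_le (mul_pos hα hlam) hqα₁
  have hq₂ : 0 < q₂ := lt_of_lt_of_le (mul_pos hα hmu) hqα₂
  obtain ⟨x₁, x₂, t, P, hxK, hx₂, hxq, ht1, htc, hxt, hPpol, hP⟩ :=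
    exists_sector_side hcomp hu hus husu hpsu hpsv hmu hα hσ husv hq₂ hqs hqα₂ hmax hcoord
  obtain ⟨z₁, z₂, r, Q, hzK, hz₂, hzq, hr1, hrc, hzr, hQpol, hQ⟩ :=
    exists_sector_side hcomp hv hvs hvsv hpsv hpsu (lam := mu) (mu := lam) (q₁ := q₂) (q₂ := q₁)
      hlam hα (by linarith) hvsu hq₁ (by linarith) hqα₁
      (by intro y hy; linarith [hmax y hy])
      (by
        intro y hy
        obtain ⟨a, b, h⟩ := hcoord y hy
        exact ⟨b, a, by rw [h, add_comm]⟩)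
  rw [add_comm (z₁ • v)] at hzK
  have ht0 : 0 < t := by linarith
  have hr0 : 0 < r := by linarith
  obtain ⟨s, hs⟩ : ∃ s, s = q₁ + q₂ := ⟨_, rfl⟩
  have hs1 : 1 < s := by rw [hs, hqs]; have := mul_pos hα hσ0; linarith
  have hs0 : 0 < s := by linarith
  have hwpol : s⁻¹ • ps ∈ polarBody K := by
    intro y hy
    rw [real_inner_smul_left, inv_mul_le_iff₀ hs0, mul_one, hs]
    exact hmax y hy
  -- the primal fan
  have hx₁ : 0 ≤ x₁ := by
    have : 0 ≤ x₁ * q₂ := by linarith [mul_nonneg hx₂ hq₁.le]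
    exact nonneg_of_mul_nonneg_left this hq₂
  have hz₁ : 0 ≤ z₁ := by
    have : 0 ≤ z₁ * q₁ := by linarith [mul_nonneg hz₂ hq₂.le]
    exact nonneg_of_mul_nonneg_left this hq₁
  have hmem : ∀ a b : ℝ, 0 ≤ a → 0 ≤ b → a • u + b • v ∈ K →
      a • u + b • v ∈ K ∩ convexHull ℝ {0, u, v, p} := fun a b ha hb hab =>
    ⟨hab, smul_add_smul_mem_sector_hull hlam hmu hp ha hb (hcon a b hab).1 (hcon a b hab).2⟩
  have hCcomp : IsCompact (K ∩ convexHull ℝ {0, u, v, p}) :=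
    hcomp.inter (isCompact_convexHull_four _ _ _ _)
  have hCarea : (q₂ * t + q₁ * r) / 2 ≤
      |(planeCross u v)⁻¹| * area (K ∩ convexHull ℝ {0, u, v, p}) := by
    have hk : ∀ a b c e : ℝ, (planeCross u v)⁻¹ *
        planeCross (a • u + b • v) (c • u + e • v) = a * e - b * c := by
      intro a b c e
      rw [planeCross_combination]
      field_simp
    have := half_fan_le_area (κ := (planeCross u v)⁻¹) hCcomp.measure_lt_top.ne
      hCcomp.measurableSet (hconv.inter (convex_convexHull ℝ _))
      ⟨h0, subset_convexHull ℝ _ (by simp)⟩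
      (hmem 1 0 (by simp) le_rfl (by simpa using hu)) (hmem x₁ x₂ hx₁ hx₂ hxK)
      (hmem q₁ q₂ hq₁.le hq₂.le hq) (hmem z₂ z₁ hz₂ hz₁ hzK)
      (hmem 0 1 le_rfl (by simp) (by simpa using hv))
      (by rw [hk]; linarith) (by rw [hk]; linarith) (by rw [hk]; linarith)
      (by rw [hk]; linarith) (by rw [hk]; linarith) (by rw [hk]; linarith)
    refine le_trans (le_of_eq ?_) this
    simp only [mul_add]
    rw [hk, hk, hk, hk]
    linear_combination (-hxt - hzr) / 2
  -- the dual fan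
  obtain ⟨A, hA⟩ : ∃ A, A = α * mu / q₂ := ⟨_, rfl⟩
  obtain ⟨B, hB⟩ : ∃ B, B = α * lam / q₁ := ⟨_, rfl⟩
  have hA0 : 0 ≤ A := by rw [hA]; positivity
  have hB0 : 0 ≤ B := by rw [hB]; positivity
  have hA1 : 0 ≤ 1 - A := by rw [hA, sub_nonneg, div_le_one hq₂]; exact hqα₂
  have hB1 : 0 ≤ 1 - B := by rw [hB, sub_nonneg, div_le_one hq₁]; exact hqα₁
  rw [← hA] at hP
  rw [← hB] at hQ
  have hus_v : ⟪us, v⟫ = 1 - (lam + mu - 1) / mu := by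
    field_simp; linear_combination husv
  have hvs_u : ⟪vs, u⟫ = 1 - (lam + mu - 1) / lam := by
    field_simp; linear_combination hvsu
  have hhull := convex_convexHull ℝ ({0, us, vs, ps} : Set ℂ)
  have hh0 : (0 : ℂ) ∈ convexHull ℝ {0, us, vs, ps} := subset_convexHull ℝ _ (by simp)
  have hhus : us ∈ convexHull ℝ {0, us, vs, ps} := subset_convexHull ℝ _ (by simp)
  have hhvs : vs ∈ convexHull ℝ {0, us, vs, ps} := subset_convexHull ℝ _ (by simp)
  have hhps : ps ∈ convexHull ℝ {0, us, vs, ps} := subset_convexHull ℝ _ (by simp)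
  have hscale : ∀ (c : ℝ) (X : ℂ), 1 ≤ c → X ∈ convexHull ℝ {0, us, vs, ps} →
      c⁻¹ • X ∈ convexHull ℝ {0, us, vs, ps} := fun c X hc hX =>
    hhull.smul_mem_of_zero_mem hh0 hX ⟨by positivity, inv_le_one_of_one_le₀ hc⟩
  have hPh : P ∈ convexHull ℝ {0, us, vs, ps} := by
    rw [hP]; exact hhull hhus hhps hA0 hA1 (by ring)
  have hQh : Q ∈ convexHull ℝ {0, us, vs, ps} := by
    rw [hQ]; exact hhull hhvs hhps hB0 hB1 (by ring)
  have hCscomp : IsCompact (polarBody K ∩ convexHull ℝ {0, us, vs, ps}) :=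
    (isCompact_convexHull_four _ _ _ _).inter_left (isClosed_polarBody K)
  have hCsarea : (lam + mu - 1) / s *
      (((q₂ + (q₂ - α * mu) * (s - 1)) / q₂) / (mu * t) +
        ((q₁ + (q₁ - α * lam) * (s - 1)) / q₁) / (lam * r)) / 2 ≤
      |planeCross u v| * area (polarBody K ∩ convexHull ℝ {0, us, vs, ps}) := by
    have i1 : ∀ (c : ℝ) (X Y : ℂ), ⟪c • X, Y⟫ = c * ⟪X, Y⟫ := fun c X Y =>
      real_inner_smul_left X Y c
    have c1 : planeCross u v * planeCross us (t⁻¹ • P) =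
        (lam + mu - 1) * (1 - A) / (mu * t) := by
      rw [planeCross_mul_planeCross, hP]
      simp only [inner_add_left, i1, husu, hpsu, hpsv, hus_v]
      field_simp; ring
    have c2 : planeCross u v * planeCross (t⁻¹ • P) (s⁻¹ • ps) =
        (lam + mu - 1) * A / (mu * t * s) := by
      rw [planeCross_mul_planeCross, hP]
      simp only [inner_add_left, i1, husu, hpsu, hpsv, hus_v]
      field_simp; ring
    have c3 : planeCross u v * planeCross us (s⁻¹ • ps) = (lam + mu - 1) / (mu * s) := by
      rw [planeCross_mul_planeCross]
      simp only [i1, husu, hpsu, hpsv, hus_v]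
      field_simp; ring
    have c4 : planeCross u v * planeCross (s⁻¹ • ps) (r⁻¹ • Q) =
        (lam + mu - 1) * B / (lam * r * s) := by
      rw [planeCross_mul_planeCross, hQ]
      simp only [inner_add_left, i1, hvsv, hpsu, hpsv, hvs_u]
      field_simp; ring
    have c5 : planeCross u v * planeCross (r⁻¹ • Q) vs =
        (lam + mu - 1) * (1 - B) / (lam * r) := by
      rw [planeCross_mul_planeCross, hQ]
      simp only [inner_add_left, i1, hvsv, hpsu, hpsv, hvs_u]
      field_simp; ring
    have c6 : planeCross u v * planeCross (s⁻¹ • ps) vs = (lam + mu - 1) / (lam * s) := by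
      rw [planeCross_mul_planeCross]
      simp only [i1, hvsv, hpsu, hpsv, hvs_u]
      field_simp; ring
    have := half_fan_le_area (κ := planeCross u v) hCscomp.measure_lt_top.ne
      hCscomp.measurableSet ((convex_polarBody K).inter hhull) ⟨zero_mem_polarBody K, hh0⟩
      ⟨hus, hhus⟩ ⟨hPpol, hscale t P ht1 hPh⟩ ⟨hwpol, hscale s ps hs1.le hhps⟩
      ⟨hQpol, hscale r Q hr1 hQh⟩ ⟨hvs, hhvs⟩
      (by rw [c1]; positivity) (by rw [c2]; positivity) (by rw [c3]; positivity)
      (by rw [c4]; positivity) (by rw [c5]; positivity) (by rw [c6]; positivity)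
    refine le_trans (le_of_eq ?_) this
    simp only [mul_add]
    rw [c1, c2, c4, c5, hA, hB]
    field_simp
    ring
  -- combining the two
  have hsσ : s ≤ lam + mu := by
    rw [hs, hqs]; linarith [mul_le_mul_of_nonneg_right hα1 hσ0.le]
  have hη : (q₂ - α * mu) * (s - 1) + (q₁ - α * lam) * (s - 1) =
      α * (1 - α) * (lam + mu - 1) := by
    have : s - 1 = α * (lam + mu - 1) := by rw [hs, hqs]; ring
    have h2 : q₂ = 1 + α * (lam + mu - 1) - q₁ := by linarith
    rw [this, h2]; ring
  have hbd : ∀ a b m n : ℝ, 0 < m → 0 < n → m + n = lam + mu → α * n ≤ b → a + b = s →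
      a + (a - α * m) * (s - 1) ≤ 1 + m + n / 4 := by
    intro a b m n hm hn hmn hb hab
    have hs' : s = 1 + α * (m + n - 1) := by rw [hmn, hs, hqs]
    have ha : a ≤ 1 - α + α * m := by linarith
    have h1 : a + (a - α * m) * (s - 1) ≤ (1 - α + α * m) * s - α * m * (s - 1) := by
      linarith [mul_le_mul_of_nonneg_right ha hs0.le]
    have h2 : (1 - α + α * m) * s - α * m * (s - 1) = 1 + m + n / 4 - (α * (1 - α) + α +
        m * (1 - α) ^ 2 + n * (1 - 2 * α) ^ 2 / 4) := by
      rw [hs']; ring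
    have h3 : 0 ≤ α * (1 - α) + α + m * (1 - α) ^ 2 + n * (1 - 2 * α) ^ 2 / 4 := by
      have := sub_nonneg.2 hα1
      positivity
    linarith
  have hnum := sector_numeric (s₁ := t) (s₂ := r) hlam hmu hq₁ hq₂
    (mul_nonneg (sub_nonneg.2 hqα₂) (sub_pos.2 hs1).le)
    (mul_nonneg (sub_nonneg.2 hqα₁) (sub_pos.2 hs1).le) hM0 hM1
    (le_trans (mul_le_mul_of_nonneg_left
      (hbd q₁ q₂ lam mu hlam hmu rfl hqα₂ hs.symm) hM0) hM₁)
    (le_trans (mul_le_mul_of_nonneg_left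
      (le_trans (hbd q₂ q₁ mu lam hmu hlam (by ring) hqα₁ (by linarith)) (by linarith)) hM0) hM₂)
    (by linarith) ht1 hr1 (by rw [hs]; exact htc)
    (by rw [hs, add_comm q₁ q₂] ; exact hrc)
  rw [hη, ← hs] at hnum
  have hprod := mul_le_mul hCarea hCsarea (by
    have : 0 ≤ q₂ - α * mu := by linarith
    have : 0 ≤ q₁ - α * lam := by linarith
    have : 0 ≤ s - 1 := by linarith
    positivity) (mul_nonneg (abs_nonneg _) ENNReal.toReal_nonneg)
  have habs : |(planeCross u v)⁻¹| * |planeCross u v| = 1 := by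
    rw [← abs_mul, inv_mul_cancel₀ hd, abs_one]
  have hfin := mul_le_mul_of_nonneg_left hnum
    (show 0 ≤ (lam + mu - 1) / (4 * s * lam * mu) by positivity)
  calc _ = (lam + mu - 1) / (4 * s * lam * mu) *
        (s * (lam + mu + α * (1 - α) * (lam + mu - 1) * M)) := by field_simp
    _ ≤ _ := hfin
    _ = _ := by field_simp; ring
    _ ≤ _ := hprod
    _ = _ := by linear_combination (area (K ∩ convexHull ℝ {0, u, v, p}) *
        area (polarBody K ∩ convexHull ℝ {0, us, vs, ps})) * habs

theorem planeCross_ne_zero {u v : ℂ} (h : LinearIndependent ℝ ![u, v]) : planeCross u v ≠ 0 := by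
  rw [LinearIndependent.pair_iff] at h
  intro hd
  unfold planeCross at hd
  obtain ⟨h1, h2⟩ := h v.re (-u.re) (by apply Complex.ext <;> simp <;> linarith)
  obtain ⟨h3, h4⟩ := h v.im (-u.im) (by apply Complex.ext <;> simp <;> linarith)
  have hu : u = 0 := by apply Complex.ext <;> simp <;> linarith
  simpa using (h 1 0 (by simp [hu])).1

theorem eq_smul_add_smul {u v : ℂ} (hd : planeCross u v ≠ 0) (y : ℂ) :
    y = (planeCross y v / planeCross u v) • u + (planeCross u y / planeCross u v) • v := by
  apply Complex.ext
  · simp only [Complex.add_re, Complex.smul_re, smul_eq_mul]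
    field_simp
    unfold planeCross; ring
  · simp only [Complex.add_im, Complex.smul_im, smul_eq_mul]
    field_simp
    unfold planeCross; ring

theorem exists_nonneg_of_mem_sector_hull {u v p : ℂ} {lam mu : ℝ} (hlam : 0 < lam) (hmu : 0 < mu)
    (hp : p = lam • u + mu • v) {x : ℂ} (hx : x ∈ convexHull ℝ {0, u, v, p}) :
    ∃ a b : ℝ, 0 ≤ a ∧ 0 ≤ b ∧ x = a • u + b • v := by
  have hc : Convex ℝ {z : ℂ | ∃ a b : ℝ, 0 ≤ a ∧ 0 ≤ b ∧ z = a • u + b • v} := by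
    rintro _ ⟨a, b, ha, hb, rfl⟩ _ ⟨c, d, hc, hd, rfl⟩ s t hs ht _
    exact ⟨s * a + t * c, s * b + t * d, by positivity, by positivity, by module⟩
  refine convexHull_min ?_ hc hx
  rintro y (rfl | rfl | rfl | rfl)
  · exact ⟨0, 0, by simp⟩
  · exact ⟨1, 0, by simp⟩
  · exact ⟨0, 1, by simp⟩
  · exact ⟨lam, mu, hlam.le, hmu.le, hp⟩

theorem smul_mem_of_far_point {S : Set ℂ} (hS : Convex ℝ S) (h0 : (0 : ℂ) ∈ S) {u v : ℂ}
    (hu : u ∈ S) (hv : v ∈ S) {lam mu q₁ q₂ t β : ℝ} (hlam : 0 < lam) (hmu : 0 < mu)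
    (hσ : 1 < lam + mu) (hq : q₁ • u + q₂ • v ∈ S)
    (hray : lam * q₂ ≤ mu * q₁) (hcon : mu * q₁ + (1 - lam) * q₂ ≤ mu)
    (hβ : 0 ≤ β) (hβ1 : β ≤ 1) (hfar : lam + mu - β * (lam + mu - 1) ≤ q₁ + q₂)
    (ht0 : 0 ≤ t) (ht : β * (lam + mu - 1) ≤ lam * (1 - t)) :
    t • (lam • u + mu • v) ∈ S := by
  have hσ0 : 0 < lam + mu - 1 := by linarith
  have ht1 : 0 ≤ 1 - t :=
    nonneg_of_mul_nonneg_right (le_trans (mul_nonneg hβ hσ0.le) ht) hlam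
  rcases le_total (t * (lam + mu)) 1 with h | h
  · have := hS.smul_add_smul_mem_of_zero_mem h0 hu hv (a := t * lam) (b := t * mu)
      (by positivity) (by positivity) (by linarith)
    convert this using 1
    module
  · have hq₁ : 0 < q₁ := by
      by_contra hn
      have h1 := mul_nonpos_of_nonneg_of_nonpos hmu.le (not_lt.1 hn)
      have h2 : q₂ ≤ 0 := by
        by_contra h3
        linarith [mul_pos hlam (not_le.1 h3)]
      linarith [mul_le_mul_of_nonneg_right hβ1 hσ0.le]
    have hA : 0 ≤ t * mu + lam - 1 := by
      have : 0 ≤ (lam + mu) * (t * mu + lam - 1) := by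
        linarith [mul_le_mul_of_nonneg_left h hmu.le, mul_pos hlam hσ0]
      exact nonneg_of_mul_nonneg_right this (by linarith)
    have hkey : t * (lam + mu * q₁ - lam * q₂) ≤ q₁ := by
      have h1 := mul_nonneg hA (sub_nonneg.2 hfar)
      have h2 := mul_nonneg (sub_nonneg.2 h) (sub_nonneg.2 hcon)
      have h3 : 0 ≤ lam + β * (1 - lam) - t * (lam + mu * β) := by
        linarith [mul_nonneg (mul_nonneg hβ hmu.le) ht1]
      have h4 := mul_nonneg hσ0.le h3
      have : 0 ≤ (lam + mu - 1) * (q₁ - t * (lam + mu * q₁ - lam * q₂)) := by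
        linear_combination h1 + h2 + h4
      linarith [nonneg_of_mul_nonneg_right this hσ0]
    have := hS.smul_add_smul_mem_of_zero_mem h0 hq hv (a := t * lam / q₁)
      (b := t * (mu * q₁ - lam * q₂) / q₁) (by positivity)
      (div_nonneg (mul_nonneg ht0 (sub_nonneg.2 hray)) hq₁.le)
      (by
        rw [← add_div, div_le_one hq₁]
        linarith)
    convert this using 1
    match_scalars
    · field_simp
    · field_simp; ring

/-- Stability corollary of the quantitative sector lemma: with `p = λu + μv`,
`f`, `g` as before, `|C|·|C*| ≤ (1+ε)f(λ,μ)` for `0 < ε < g/(4f)`,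
`α_± = [1 ± √(1 − (4f/g)ε)]/2`, and `α₊ + (1−α₊)·min{(1−λ)/μ, (1−μ)/λ} > 0`,
either `C ⊆ [1+(λ+μ−1)α₋]·[o,u,v]`, or
`C ⊇ [α₊ + (1−α₊)·min{(1−λ)/μ, (1−μ)/λ}]·[o,u,v,p]`. -/
theorem sector_lemma_stability_corollary (K : Set ℂ) (hK : IsConvexBody K)
    (ho : (0 : ℂ) ∈ interior K) (u v us vs p ps : ℂ)
    (huv : LinearIndependent ℝ ![u, v])
    (hu : u ∈ frontier K) (hv : v ∈ frontier K)
    (husvs : LinearIndependent ℝ ![us, vs])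
    (hus : us ∈ frontier (polarBody K)) (hvs : vs ∈ frontier (polarBody K))
    (husu : ⟪us, u⟫ = 1) (hvsv : ⟪vs, v⟫ = 1)
    (hsupp : ∀ y ∈ K, ⟪us, y⟫ ≤ 1 ∧ ⟪vs, y⟫ ≤ 1)
    (hp : ⟪us, p⟫ = 1 ∧ ⟪vs, p⟫ = 1)
    (hpseg : (segment ℝ p 0 ∩ segment ℝ u v).Nonempty)
    (hps : ⟪ps, u⟫ = 1 ∧ ⟪ps, v⟫ = 1)
    (hpsseg : (segment ℝ ps 0 ∩ segment ℝ us vs).Nonempty)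
    (C Cs : Set ℂ)
    (hC : C = K ∩ convexHull ℝ {0, u, v, p})
    (hCs : Cs = polarBody K ∩ convexHull ℝ {0, us, vs, ps})
    (lam mu : ℝ) (hlam : 0 < lam) (hmu : 0 < mu)
    (hpdef : p = lam • u + mu • v)
    (f g ε αplus αminus : ℝ)
    (hf : f = (lam + mu) * (lam + mu - 1) / (4 * lam * mu))
    (hg : g = (1 / 4) * (lam + mu - 1) ^ 2 *
      min (min (1 / (mu * (1 + lam / 4 + mu))) (1 / (lam * (1 + lam + mu / 4))))
        (1 / (lam * mu)))
    (hε : 0 < ε) (hεsmall : ε < g / (4 * f))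
    (hαplus : αplus = (1 + Real.sqrt (1 - (4 * f / g) * ε)) / 2)
    (hαminus : αminus = (1 - Real.sqrt (1 - (4 * f / g) * ε)) / 2)
    (hpos : 0 < αplus + (1 - αplus) * min ((1 - lam) / mu) ((1 - mu) / lam))
    (hCC : area C * area Cs ≤ (1 + ε) * f) :
    C ⊆ (1 + (lam + mu - 1) * αminus) • convexHull ℝ {(0 : ℂ), u, v} ∨
      (αplus + (1 - αplus) * min ((1 - lam) / mu) ((1 - mu) / lam)) •
        convexHull ℝ {0, u, v, p} ⊆ C := by
  have hlm : 0 < lam * mu := mul_pos hlam hmu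
  obtain ⟨hconv, hcomp, -⟩ := hK
  have h0 : (0 : ℂ) ∈ K := interior_subset ho
  have huK := hcomp.isClosed.frontier_subset hu
  have hvK := hcomp.isClosed.frontier_subset hv
  have hus' := (isClosed_polarBody K).frontier_subset hus
  have hvs' := (isClosed_polarBody K).frontier_subset hvs
  have hd := planeCross_ne_zero huv
  have hpsval : ∀ a b : ℝ, ⟪ps, a • u + b • v⟫ = a + b := by
    intro a b
    rw [inner_add_right, real_inner_smul_right, real_inner_smul_right, hps.1, hps.2]; ring
  have husv : lam + mu * ⟪us, v⟫ = 1 := by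
    rw [← hp.1, hpdef, inner_add_right, real_inner_smul_right, real_inner_smul_right, husu]; ring
  have hvsu : mu + lam * ⟪vs, u⟫ = 1 := by
    rw [← hp.2, hpdef, inner_add_right, real_inner_smul_right, real_inner_smul_right, hvsv]; ring
  have hσ1 : 1 ≤ lam + mu := by
    obtain ⟨z, ⟨a, b, ha, hb, hab, rfl⟩, ⟨c, d, hc, hd', hcd, hz⟩⟩ := hpseg
    have h1 := hpsval c d
    rw [hz, smul_zero, add_zero, real_inner_smul_right, hpdef, hpsval, hcd] at h1
    have : a ≤ 1 := by linarith
    linarith [mul_le_mul_of_nonneg_right this (add_pos hlam hmu).le]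
  have hσ : 1 < lam + mu := by
    refine lt_of_le_of_ne hσ1 fun h => ?_
    rw [hf, ← h] at hεsmall
    simp at hεsmall
    linarith
  have hσ0 : 0 < lam + mu - 1 := by linarith
  obtain ⟨m, hm⟩ : ∃ m, m = min (min (1 / (mu * (1 + lam / 4 + mu)))
    (1 / (lam * (1 + lam + mu / 4)))) (1 / (lam * mu)) := ⟨_, rfl⟩
  have hm0 : 0 < m := by
    rw [hm]
    refine lt_min (lt_min ?_ ?_) ?_ <;> positivity
  rw [← hm] at hg
  have hf0 : 0 < f := by rw [hf]; positivity
  have hg0 : 0 < g := by rw [hg]; positivity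
  have hm1 : mu * lam * m * (1 + lam / 4 + mu) ≤ lam := by
    have h : m ≤ 1 / (mu * (1 + lam / 4 + mu)) := by
      rw [hm]; exact (min_le_left _ _).trans (min_le_left _ _)
    rw [le_div_iff₀ (by positivity)] at h
    linarith [mul_le_mul_of_nonneg_left h hlam.le]
  have hm2 : mu * lam * m * (1 + lam + mu / 4) ≤ mu := by
    have h : m ≤ 1 / (lam * (1 + lam + mu / 4)) := by
      rw [hm]; exact (min_le_left _ _).trans (min_le_right _ _)
    rw [le_div_iff₀ (by positivity)] at h
    linarith [mul_le_mul_of_nonneg_left h hmu.le]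
  have hm3 : mu * lam * m ≤ 1 := by
    have h : m ≤ 1 / (lam * mu) := by rw [hm]; exact min_le_right _ _
    rw [le_div_iff₀ (by positivity)] at h
    linarith
  have hcon : ∀ x₁ x₂ : ℝ, x₁ • u + x₂ • v ∈ K →
      mu * x₁ + (1 - lam) * x₂ ≤ mu ∧ (1 - mu) * x₁ + lam * x₂ ≤ lam := by
    intro x₁ x₂ hx
    have e1 := hus' _ hx
    have e2 := hvs' _ hx
    rw [inner_add_right, real_inner_smul_right, real_inner_smul_right] at e1 e2
    rw [husu] at e1
    rw [hvsv] at e2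
    have e3 := mul_le_mul_of_nonneg_left e1 hmu.le
    have e4 := mul_le_mul_of_nonneg_left e2 hlam.le
    constructor
    · linear_combination e3 - x₂ * husv
    · linear_combination e4 - x₁ * hvsu
  have hcoord : ∀ y ∈ K, ∃ y₁ y₂ : ℝ, y = y₁ • u + y₂ • v := fun y _ =>
    ⟨_, _, eq_smul_add_smul hd y⟩
  obtain ⟨q, hqK, hqmax⟩ := hcomp.exists_isMaxOn ⟨u, huK⟩
    (f := fun y => ⟪ps, y⟫) (by fun_prop)
  obtain ⟨q₁, q₂, rfl⟩ := hcoord q hqK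
  have hmax : ∀ y ∈ K, ⟪ps, y⟫ ≤ q₁ + q₂ := by
    intro y hy
    rw [← hpsval]
    exact hqmax hy
  obtain ⟨α, hα⟩ : ∃ α, α = (q₁ + q₂ - 1) / (lam + mu - 1) := ⟨_, rfl⟩
  have hqs : q₁ + q₂ = 1 + α * (lam + mu - 1) := by
    rw [hα]; field_simp; ring
  have hα0 : 0 ≤ α := by
    rw [hα]
    have := hmax u huK
    rw [hps.1] at this
    exact div_nonneg (by linarith) hσ0.le
  obtain ⟨hqc₁, hqc₂⟩ := hcon _ _ hqK
  have hα1 : α ≤ 1 := by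
    rw [hα, div_le_one hσ0]
    linarith
  obtain ⟨D, hD⟩ : ∃ D, D = 1 - 4 * f / g * ε := ⟨_, rfl⟩
  rw [← hD] at hαplus hαminus
  have hDeq : g * (1 - D) = 4 * f * ε := by rw [hD]; field_simp; ring
  have hD1 : D ≤ 1 := by
    rw [hD]; linarith [mul_pos (div_pos (mul_pos four_pos hf0) hg0) hε]
  have hD0 : 0 ≤ D := by
    rw [lt_div_iff₀ (by positivity)] at hεsmall
    have : 0 ≤ g * D := by linarith
    exact nonneg_of_mul_nonneg_right this hg0
  have hr0 := Real.sqrt_nonneg D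
  have hr1 : √D ≤ 1 := Real.sqrt_le_one.2 hD1
  have hsq := Real.sq_sqrt hD0
  have hαminus0 : 0 ≤ αminus := by rw [hαminus]; linarith
  rcases le_or_gt α αminus with hle | hgt
  · left
    intro x hx
    rw [hC] at hx
    obtain ⟨a, b, ha, hb, rfl⟩ := exists_nonneg_of_mem_sector_hull hlam hmu hpdef hx.2
    have h1 := hmax _ hx.1
    rw [hpsval, hqs] at h1
    have h2 : a + b ≤ 1 + (lam + mu - 1) * αminus := by
      linarith [mul_le_mul_of_nonneg_right hle hσ0.le]
    obtain ⟨c, hc⟩ : ∃ c, c = 1 + (lam + mu - 1) * αminus := ⟨_, rfl⟩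
    have hc0 : 0 < c := by rw [hc]; positivity
    rw [← hc] at h2 ⊢
    refine ⟨(a / c) • u + (b / c) • v, ?_, ?_⟩
    · exact (convex_convexHull ℝ _).smul_add_smul_mem_of_zero_mem
        (subset_convexHull ℝ _ (by simp)) (subset_convexHull ℝ _ (by simp))
        (subset_convexHull ℝ _ (by simp)) (by positivity) (by positivity)
        (by rw [← add_div, div_le_one hc0]; exact h2)
    · simp only [smul_add, smul_smul]
      rw [mul_div_cancel₀ a hc0.ne', mul_div_cancel₀ b hc0.ne']
  rcases lt_or_ge α αplus with hlt | hge
  · exfalso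
    have hgap : f * ε < g * (α * (1 - α)) := by
      have h1 : 0 < (α - αminus) * (αplus - α) := mul_pos (by linarith) (by linarith)
      have h2 : (α - αminus) * (αplus - α) = α * (1 - α) - (1 - D) / 4 := by
        rw [hαplus, hαminus]; linear_combination hsq / 4
      rw [h2] at h1
      linarith [mul_pos hg0 h1]
    have := sector_area_mul_area_ge hconv hcomp h0 hd huK hvK hus' hvs' husu hvsv hps.1 hps.2
      hlam hmu hσ hpdef husv hvsu (lt_of_le_of_lt hαminus0 hgt) hα1 hqK hqs hmax hcoord
      (M := mu * lam * m) (by positivity) hm3 hm2 hm1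
    rw [← hC, ← hCs] at this
    have heq : (lam + mu - 1) * (lam + mu + α * (1 - α) * (lam + mu - 1) * (mu * lam * m)) /
        (4 * lam * mu) = f + g * (α * (1 - α)) := by
      rw [hf, hg]; field_simp
    linarith
  · right
    obtain ⟨b, hb⟩ : ∃ b, b = min ((1 - lam) / mu) ((1 - mu) / lam) := ⟨_, rfl⟩
    rw [← hb] at hpos ⊢
    have hαplus1 : 0 ≤ 1 - αplus := by rw [hαplus]; linarith
    have hαplus0 : 0 ≤ αplus := by rw [hαplus]; linarith
    obtain ⟨t, ht⟩ : ∃ t, t = αplus + (1 - αplus) * b := ⟨_, rfl⟩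
    rw [← ht] at hpos ⊢
    have htlam : (1 - αplus) * (lam + mu - 1) ≤ lam * (1 - t) := by
      have h1 : b ≤ (1 - mu) / lam := by rw [hb]; exact min_le_right _ _
      rw [le_div_iff₀ hlam] at h1
      rw [ht]
      linarith [mul_le_mul_of_nonneg_left h1 hαplus1]
    have htmu : (1 - αplus) * (lam + mu - 1) ≤ mu * (1 - t) := by
      have h1 : b ≤ (1 - lam) / mu := by rw [hb]; exact min_le_left _ _
      rw [le_div_iff₀ hmu] at h1
      rw [ht]
      linarith [mul_le_mul_of_nonneg_left h1 hαplus1]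
    have ht1 : 0 ≤ 1 - t :=
      nonneg_of_mul_nonneg_right (le_trans (mul_nonneg hαplus1 hσ0.le) htlam) hlam
    have hq₁ : 0 ≤ q₁ := by
      have : 0 ≤ (lam + mu - 1) * q₁ := by
        linear_combination hqc₂ - lam * hqs + mul_nonneg (mul_nonneg hlam.le hα0) hσ0.le
      exact nonneg_of_mul_nonneg_right this hσ0
    have hq₂ : 0 ≤ q₂ := by
      have : 0 ≤ (lam + mu - 1) * q₂ := by
        linear_combination hqc₁ - mu * hqs + mul_nonneg (mul_nonneg hmu.le hα0) hσ0.le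
      exact nonneg_of_mul_nonneg_right this hσ0
    have hfar : lam + mu - (1 - αplus) * (lam + mu - 1) ≤ q₁ + q₂ := by
      linarith [mul_le_mul_of_nonneg_right hge hσ0.le]
    have hCconv : Convex ℝ C := by rw [hC]; exact hconv.inter (convex_convexHull ℝ _)
    have h0C : (0 : ℂ) ∈ C := by rw [hC]; exact ⟨h0, subset_convexHull ℝ _ (by simp)⟩
    have huC : u ∈ C := by rw [hC]; exact ⟨huK, subset_convexHull ℝ _ (by simp)⟩
    have hvC : v ∈ C := by rw [hC]; exact ⟨hvK, subset_convexHull ℝ _ (by simp)⟩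
    have hqC : q₁ • u + q₂ • v ∈ C := by
      rw [hC]; exact ⟨hqK, smul_add_smul_mem_sector_hull hlam hmu hpdef hq₁ hq₂ hqc₁ hqc₂⟩
    have hpC : t • p ∈ C := by
      rw [hpdef]
      rcases le_total (lam * q₂) (mu * q₁) with h | h
      · exact smul_mem_of_far_point hCconv h0C huC hvC hlam hmu hσ hqC h hqc₁ hαplus1
          (by linarith) hfar hpos.le htlam
      · rw [add_comm]
        rw [add_comm] at hqC
        exact smul_mem_of_far_point hCconv h0C hvC huC hmu hlam (by linarith) hqC h
          (by linarith) hαplus1 (by linarith) (by linarith) hpos.le (by linarith)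
    have hsub : convexHull ℝ {0, u, v, p} ⊆ (fun z => t • z) ⁻¹' C := by
      refine convexHull_min ?_ (hCconv.smul_preimage t)
      have hs : ∀ w ∈ C, t • w ∈ C := fun w hw =>
        hCconv.smul_mem_of_zero_mem h0C hw ⟨hpos.le, by linarith⟩
      rintro y (rfl | rfl | rfl | rfl)
      · exact hs _ h0C
      · exact hs _ huC
      · exact hs _ hvC
      · exact hpC
    rintro _ ⟨y, hy, rfl⟩
    exact hsub hy
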